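/- Let K be an algebraically closed field, complete with respect to a nontrivial non-Archimedean absolute value |·|. Let b ∈ K, let r > 0 be a real number, and let f(z) = ∑_{n≥0} c_n (z − b)^n be a nonzero power series with |c_n| r^n → 0 (so f converges on the closed ball B̄ = {z : |z − b| ≤ r}), and suppose f has a zero in B̄. Then there exists ε > 0 such that every power series g(z) = ∑_{n≥0} d_n (z − b)^n with |d_n| r^n → 0 and |c_n − d_n| < ε for all n ≤ K(f,r) has a zero in B̄. -/

import Mathlib

open Filter

/-- `M` is the largest index at which the sequence `a` attains its maximum. -/
def IsLastMaxIndex (a : ℕ → ℝ) (M : ℕ) : Prop :=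
  (∀ j, a j ≤ a M) ∧ ∀ j, M < j → a j < a M

theorem IsLastMaxIndex.unique {a : ℕ → ℝ} {M M' : ℕ} (h : IsLastMaxIndex a M)
    (h' : IsLastMaxIndex a M') : M = M' := by
  rcases lt_trichotomy M M' with hlt | heq | hlt
  · exact absurd (h.2 _ hlt) (h'.1 _).not_gt
  · exact heq
  · exact absurd (h'.2 _ hlt) (h.1 _).not_gt

theorem exists_isLastMaxIndex_of_tendsto_zero {a : ℕ → ℝ} (ha : Tendsto a atTop (nhds 0))
    {N : ℕ} (hN : 0 < a N) : ∃ M, IsLastMaxIndex a M := by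
  obtain ⟨T, hT⟩ := eventually_atTop.1 (ha.eventually_lt_const hN)
  obtain ⟨M, -, hM⟩ := (Finset.range (T + N + 1)).exists_max_image (fun n => toLex (a n, n))
    ⟨N, by simp⟩
  simp only [Finset.mem_range, Prod.Lex.toLex_le_toLex] at hM
  have hNM : a N ≤ a M := by
    rcases hM N (by omega) with h | h
    · exact h.le
    · exact h.1.le
  refine ⟨M, fun j => ?_, fun j hj => ?_⟩
  · by_cases hjT : T ≤ j
    · exact ((hT j hjT).trans_le hNM).le
    · rcases hM j (by omega) with h | h
      · exact h.le
      · exact h.1.le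
  · by_cases hjT : T ≤ j
    · exact (hT j hjT).trans_le hNM
    · rcases hM j (by omega) with h | h
      · exact h
      · exact absurd h.2 hj.not_ge

section Ultrametric

variable {K : Type*} [NormedField K] [IsUltrametricDist K]

open Polynomial

theorem norm_sub_le_max_norm (x y : K) : ‖x - y‖ ≤ max ‖x‖ ‖y‖ := by
  rw [sub_eq_add_neg, ← norm_neg y]
  exact IsUltrametricDist.norm_add_le_max x (-y)

theorem norm_sub_eq_left_of_norm_lt {x y : K} (h : ‖y‖ < ‖x‖) : ‖x - y‖ = ‖x‖ := by
  rw [sub_eq_add_neg, IsUltrametricDist.norm_add_eq_max_of_norm_ne_norm (by simpa using h.ne')]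
  simpa using h.le

theorem norm_sub_eq_right_of_norm_lt {x y : K} (h : ‖x‖ < ‖y‖) : ‖x - y‖ = ‖y‖ := by
  rw [norm_sub_rev, norm_sub_eq_left_of_norm_lt h]

theorem norm_sub_mul_lt_of_lt {x y : K} {c t : ℝ} (hc : 0 ≤ c) (hx : ‖x‖ * c < t)
    (hy : ‖y‖ * c < t) : ‖x - y‖ * c < t := by
  refine (mul_le_mul_of_nonneg_right (norm_sub_le_max_norm x y) hc).trans_lt ?_
  rcases max_choice ‖x‖ ‖y‖ with h | h <;> rwa [h]

theorem norm_sub_mul_le_of_le {x y : K} {c t : ℝ} (hc : 0 ≤ c) (hx : ‖x‖ * c ≤ t)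
    (hy : ‖y‖ * c ≤ t) : ‖x - y‖ * c ≤ t := by
  refine (mul_le_mul_of_nonneg_right (norm_sub_le_max_norm x y) hc).trans ?_
  rcases max_choice ‖x‖ ‖y‖ with h | h <;> rwa [h]

theorem coeff_X_sub_C_mul_succ {R : Type*} [CommRing R] (Q : R[X]) (α : R) (j : ℕ) :
    ((X - C α) * Q).coeff (j + 1) = Q.coeff j - α * Q.coeff (j + 1) := by
  simp [sub_mul]

theorem coeff_X_sub_C_mul_zero {R : Type*} [CommRing R] (Q : R[X]) (α : R) :
    ((X - C α) * Q).coeff 0 = 0 - α * Q.coeff 0 := by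
  simp [sub_mul]

theorem isLastMaxIndex_X_sub_C_mul_of_norm_le {r : ℝ} (hr : 0 < r) {Q : K[X]} {m : ℕ}
    (hQ : IsLastMaxIndex (fun j => ‖Q.coeff j‖ * r ^ j) m) {α : K} (hα : ‖α‖ ≤ r) :
    ‖((X - C α) * Q).coeff (m + 1)‖ = ‖Q.coeff m‖ ∧
      IsLastMaxIndex (fun j => ‖((X - C α) * Q).coeff j‖ * r ^ j) (m + 1) := by
  obtain ⟨h1, h2⟩ := hQ
  have hshift : ∀ j, ‖α * Q.coeff j‖ * r ^ j ≤ r * (‖Q.coeff j‖ * r ^ j) := fun j => by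
    rw [norm_mul, mul_assoc]
    gcongr
  have hlead : ‖((X - C α) * Q).coeff (m + 1)‖ = ‖Q.coeff m‖ := by
    rw [coeff_X_sub_C_mul_succ]
    refine norm_sub_eq_left_of_norm_lt (lt_of_mul_lt_mul_right ?_ (pow_nonneg hr.le (m + 1)))
    calc _ ≤ r * (‖Q.coeff (m + 1)‖ * r ^ (m + 1)) := hshift _
      _ < r * (‖Q.coeff m‖ * r ^ m) := by exact mul_lt_mul_of_pos_left (h2 _ (Nat.lt_succ_self m)) (by positivity)
      _ = _ := by ring
  have htop : ‖((X - C α) * Q).coeff (m + 1)‖ * r ^ (m + 1) = r * (‖Q.coeff m‖ * r ^ m) := by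
    rw [hlead]; ring
  have hsucc : ∀ j, ‖Q.coeff j‖ * r ^ (j + 1) = r * (‖Q.coeff j‖ * r ^ j) := fun j => by ring
  refine ⟨hlead, fun j => ?_, fun j hj => ?_⟩
  · simp only [htop]
    cases j with
    | zero =>
      rw [coeff_X_sub_C_mul_zero]
      refine norm_sub_mul_le_of_le (by positivity) (by rw [norm_zero, zero_mul]; positivity) ((hshift 0).trans ?_)
      exact mul_le_mul_of_nonneg_left (h1 0) (by positivity)
    | succ j =>
      rw [coeff_X_sub_C_mul_succ]
      refine norm_sub_mul_le_of_le (by positivity) ?_ ((hshift _).trans ?_)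
      · rw [hsucc]; exact mul_le_mul_of_nonneg_left (h1 j) (by positivity)
      · exact mul_le_mul_of_nonneg_left (h1 (j + 1)) (by positivity)
  · simp only [htop]
    cases j with
    | zero => omega
    | succ j =>
      rw [coeff_X_sub_C_mul_succ]
      refine norm_sub_mul_lt_of_lt (by positivity) ?_ ((hshift _).trans_lt ?_)
      · rw [hsucc]; exact mul_lt_mul_of_pos_left (h2 j (by omega)) (by positivity)
      · exact mul_lt_mul_of_pos_left (h2 (j + 1) (by omega)) (by positivity)

theorem isLastMaxIndex_X_sub_C_mul_of_lt_norm {r : ℝ} (hr : 0 < r) {Q : K[X]} {m : ℕ}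
    (hQ : IsLastMaxIndex (fun j => ‖Q.coeff j‖ * r ^ j) m) {α : K} (hα : r < ‖α‖) :
    ‖((X - C α) * Q).coeff m‖ = ‖α‖ * ‖Q.coeff m‖ ∧
      IsLastMaxIndex (fun j => ‖((X - C α) * Q).coeff j‖ * r ^ j) m := by
  obtain ⟨h1, h2⟩ := hQ
  have hα0 : 0 < ‖α‖ := hr.trans hα
  have hpos : 0 < ‖Q.coeff m‖ * r ^ m :=
    lt_of_le_of_lt (by positivity) (h2 (m + 1) (Nat.lt_succ_self m))
  have hq : 0 < ‖Q.coeff m‖ := pos_of_mul_pos_left hpos (by positivity)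
  have hshift : ∀ j, ‖α * Q.coeff j‖ * r ^ j = ‖α‖ * (‖Q.coeff j‖ * r ^ j) := fun j => by
    rw [norm_mul, mul_assoc]
  have hsucc : ∀ j, ‖Q.coeff j‖ * r ^ (j + 1) < ‖α‖ * (‖Q.coeff m‖ * r ^ m) := fun j =>
    calc _ = r * (‖Q.coeff j‖ * r ^ j) := by ring
      _ ≤ r * (‖Q.coeff m‖ * r ^ m) := by exact mul_le_mul_of_nonneg_left (h1 j) (by positivity)
      _ < _ := by gcongr
  have hlead : ‖((X - C α) * Q).coeff m‖ = ‖α‖ * ‖Q.coeff m‖ := by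
    rw [← norm_mul]
    cases m with
    | zero => rw [coeff_X_sub_C_mul_zero, zero_sub, norm_neg]
    | succ m =>
      rw [coeff_X_sub_C_mul_succ]
      refine norm_sub_eq_right_of_norm_lt
        (lt_of_mul_lt_mul_right ?_ (pow_nonneg hr.le (m + 1)))
      rw [hshift]
      exact hsucc m
  have htop : ‖((X - C α) * Q).coeff m‖ * r ^ m = ‖α‖ * (‖Q.coeff m‖ * r ^ m) := by
    rw [hlead, mul_assoc]
  refine ⟨hlead, fun j => ?_, fun j hj => ?_⟩
  · simp only [htop]
    cases j with
    | zero =>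
      rw [coeff_X_sub_C_mul_zero]
      refine norm_sub_mul_le_of_le (by positivity) (by rw [norm_zero, zero_mul]; positivity) ((hshift 0).trans_le ?_)
      exact mul_le_mul_of_nonneg_left (h1 0) (by positivity)
    | succ j =>
      rw [coeff_X_sub_C_mul_succ]
      refine norm_sub_mul_le_of_le (by positivity) (hsucc j).le ((hshift _).trans_le ?_)
      exact mul_le_mul_of_nonneg_left (h1 (j + 1)) (by positivity)
  · simp only [htop]
    cases j with
    | zero => omega
    | succ j =>
      rw [coeff_X_sub_C_mul_succ]
      refine norm_sub_mul_lt_of_lt (by positivity) (hsucc j) ((hshift _).trans_lt ?_)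
      exact mul_lt_mul_of_pos_left (h2 (j + 1) (by omega)) (by positivity)

/-- For a product of linear factors, the last maximal index of the weighted coefficients is the
number of roots in the closed ball, and the value at a point of the ball is controlled from below
by the distance to these roots. -/
theorem isLastMaxIndex_prod_X_sub_C {r : ℝ} (hr : 0 < r) (s : Multiset K) :
    ∃ m, (m ≠ 0 → ∃ α ∈ s, ‖α‖ ≤ r) ∧
      IsLastMaxIndex (fun j => ‖(s.map fun α => X - C α).prod.coeff j‖ * r ^ j) m ∧
      ∀ (w : K) (δ : ℝ), ‖w‖ ≤ r → 0 ≤ δ → (∀ α ∈ s, ‖α‖ ≤ r → δ ≤ ‖w - α‖) →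
        ‖(s.map fun α => X - C α).prod.coeff m‖ * δ ^ m ≤
          ‖(s.map fun α => X - C α).prod.eval w‖ := by
  induction s using Multiset.induction_on with
  | empty =>
    refine ⟨0, by simp, ⟨fun j => ?_, fun j hj => ?_⟩, fun w δ _ _ _ => by simp⟩
    · cases j <;> simp [coeff_one]
    · simp [coeff_one, hj.ne']
  | cons α s ih =>
    obtain ⟨m, hm0, hm, hw⟩ := ih
    simp only [Multiset.map_cons, Multiset.prod_cons]
    by_cases hα : ‖α‖ ≤ r
    · obtain ⟨hlead, hmax⟩ := isLastMaxIndex_X_sub_C_mul_of_norm_le hr hm hα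
      refine ⟨m + 1, fun _ => ⟨α, by simp, hα⟩, hmax, fun w δ hwr hδ h => ?_⟩
      rw [hlead, eval_mul, norm_mul, pow_succ', mul_left_comm]
      have h1 := h α (by simp) hα
      have h2 := hw w δ hwr hδ fun β hβ => h β (by simp [hβ])
      simp only [eval_sub, eval_X, eval_C]
      gcongr
    · push Not at hα
      obtain ⟨hlead, hmax⟩ := isLastMaxIndex_X_sub_C_mul_of_lt_norm hr hm hα
      refine ⟨m, fun h => ?_, hmax, fun w δ hwr hδ h => ?_⟩
      · obtain ⟨β, hβ, hβr⟩ := hm0 h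
        exact ⟨β, by simp [hβ], hβr⟩
      · have h2 := hw w δ hwr hδ fun β hβ => h β (by simp [hβ])
        rw [hlead, eval_mul, norm_mul, mul_assoc, eval_sub, eval_X, eval_C,
          norm_sub_eq_right_of_norm_lt (hwr.trans_lt hα)]
        gcongr

theorem exists_root_near [IsAlgClosed K] {r : ℝ} (hr : 0 < r) {P : K[X]} {M : ℕ}
    (hP : IsLastMaxIndex (fun j => ‖P.coeff j‖ * r ^ j) M) (hM : M ≠ 0) {w : K} (hw : ‖w‖ ≤ r) :
    ∃ α, ‖α‖ ≤ r ∧ P.eval α = 0 ∧ ‖P.coeff M‖ * ‖w - α‖ ^ M ≤ ‖P.eval w‖ := by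
  classical
  have hP0 : P ≠ 0 := by
    rintro rfl
    simpa using hP.2 (M + 1) (Nat.lt_succ_self M)
  have hl : 0 < ‖P.leadingCoeff‖ := norm_pos_iff.2 (leadingCoeff_ne_zero.2 hP0)
  have hfac := (IsAlgClosed.splits P).eq_prod_roots
  obtain ⟨m, hm0, hm, hbound⟩ := isLastMaxIndex_prod_X_sub_C hr P.roots
  set Q := (P.roots.map fun α => X - C α).prod
  have hcoeff : ∀ j, ‖P.coeff j‖ = ‖P.leadingCoeff‖ * ‖Q.coeff j‖ := fun j => by
    conv_lhs => rw [hfac, coeff_C_mul, norm_mul]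
  have heval : ‖P.eval w‖ = ‖P.leadingCoeff‖ * ‖Q.eval w‖ := by
    conv_lhs => rw [hfac, eval_mul, eval_C, norm_mul]
  have hmM : m = M := by
    refine IsLastMaxIndex.unique ?_ hP
    simp only [IsLastMaxIndex, hcoeff, mul_assoc]
    exact ⟨fun j => mul_le_mul_of_nonneg_left (hm.1 j) hl.le,
      fun j hj => mul_lt_mul_of_pos_left (hm.2 j hj) hl⟩
  subst hmM
  obtain ⟨β, hβ, hβr⟩ := hm0 hM
  obtain ⟨α, hα, hmin⟩ := (P.roots.toFinset.filter fun α => ‖α‖ ≤ r).exists_min_image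
    (fun α => ‖w - α‖) ⟨β, by simpa [hβr] using hβ⟩
  simp only [Finset.mem_filter, Multiset.mem_toFinset] at hα hmin
  refine ⟨α, hα.2, (mem_roots hP0).1 hα.1, ?_⟩
  rw [hcoeff, heval, mul_assoc]
  exact mul_le_mul_of_nonneg_left
    (hbound w _ hw (norm_nonneg _) fun γ hγ hγr => hmin γ ⟨hγ, hγr⟩) hl.le

theorem norm_pow_sub_pow_mul_le {r : ℝ} {x y : K} (hx : ‖x‖ ≤ r)
    (hy : ‖y‖ ≤ r) (k : ℕ) : ‖x ^ k - y ^ k‖ * r ≤ ‖x - y‖ * r ^ k := by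
  have hr : 0 ≤ r := (norm_nonneg x).trans hx
  induction k with
  | zero => simp
  | succ k ih =>
    have h : x ^ (k + 1) - y ^ (k + 1) = x * (x ^ k - y ^ k) - (y - x) * y ^ k := by ring
    rw [h]
    refine norm_sub_mul_le_of_le hr ?_ ?_
    · calc ‖x * (x ^ k - y ^ k)‖ * r = ‖x‖ * (‖x ^ k - y ^ k‖ * r) := by rw [norm_mul]; ring
        _ ≤ r * (‖x - y‖ * r ^ k) := by gcongr
        _ = _ := by ring
    · calc ‖(y - x) * y ^ k‖ * r = ‖x - y‖ * ‖y‖ ^ k * r := by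
            rw [norm_mul, norm_pow, norm_sub_rev]
        _ ≤ ‖x - y‖ * r ^ k * r := by gcongr
        _ = _ := by ring

theorem hasSum_zero_of_tendsto_partial_sums [CompleteSpace K] {r : ℝ} {d : ℕ → K}
    (hd : Tendsto (fun n => ‖d n‖ * r ^ n) atTop (nhds 0)) {w : K} (hw : ‖w‖ ≤ r)
    (hlim : Tendsto (fun n => ∑ k ∈ Finset.range n, d k * w ^ k) atTop (nhds 0)) :
    HasSum (fun n => d n * w ^ n) 0 := by
  have : Summable fun n => d n * w ^ n := by
    refine NonarchimedeanAddGroup.summable_of_tendsto_cofinite_zero ?_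
    rw [Nat.cofinite_eq_atTop]
    refine squeeze_zero_norm (fun n => ?_) hd
    rw [norm_mul, norm_pow]
    gcongr
  rw [← tendsto_nhds_unique this.hasSum.tendsto_sum_nat hlim]
  exact this.hasSum

theorem exists_zero_of_isLastMaxIndex [IsAlgClosed K] [CompleteSpace K] {r : ℝ} (hr : 0 < r)
    {d : ℕ → K} (hd : Tendsto (fun n => ‖d n‖ * r ^ n) atTop (nhds 0)) {M : ℕ}
    (hM : IsLastMaxIndex (fun n => ‖d n‖ * r ^ n) M) (hM0 : M ≠ 0) :
    ∃ w, ‖w‖ ≤ r ∧ HasSum (fun n => d n * w ^ n) 0 := by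
  have hpos : 0 < ‖d M‖ * r ^ M :=
    lt_of_le_of_lt (by positivity) (hM.2 (M + 1) (Nat.lt_succ_self M))
  have hdM : 0 < ‖d M‖ := pos_of_mul_pos_left hpos (by positivity)
  let P : ℕ → K[X] := fun n => ∑ k ∈ Finset.range (n + M + 1), C (d k) * X ^ k
  have hcoeff : ∀ n j, (P n).coeff j = if j < n + M + 1 then d j else 0 := fun n j => by
    simp [P, coeff_X_pow]
  have heval : ∀ n w, (P n).eval w = ∑ k ∈ Finset.range (n + M + 1), d k * w ^ k := fun n w => by
    simp [P, eval_finsetSum]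
  have hcM : ∀ n, (P n).coeff M = d M := fun n => by
    rw [hcoeff, if_pos (by omega)]
  have hP : ∀ n, IsLastMaxIndex (fun j => ‖(P n).coeff j‖ * r ^ j) M := fun n => by
    refine ⟨fun j => ?_, fun j hj => ?_⟩ <;> simp only [hcM] <;> rw [hcoeff] <;> split_ifs
    · exact hM.1 j
    · simpa using hpos.le
    · exact hM.2 j hj
    · simpa using hpos
  have hstep : ∀ n (x : {x : K // ‖x‖ ≤ r ∧ (P n).eval x = 0}),
      ∃ y : {y : K // ‖y‖ ≤ r ∧ (P (n + 1)).eval y = 0},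
        ‖(y : K) - x‖ ^ M ≤ ‖d (n + M + 1)‖ * r ^ (n + M + 1) / ‖d M‖ := by
    rintro n ⟨x, hx, hx0⟩
    obtain ⟨y, hy, hy0, hxy⟩ := exists_root_near hr (hP (n + 1)) hM0 hx
    refine ⟨⟨y, hy, hy0⟩, ?_⟩
    have hx1 : (P (n + 1)).eval x = d (n + M + 1) * x ^ (n + M + 1) := by
      rw [heval] at hx0 ⊢
      rw [show n + 1 + M + 1 = n + M + 1 + 1 by ring, Finset.sum_range_succ, hx0, zero_add]
    rw [hcM, hx1, norm_mul, norm_pow] at hxy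
    rw [le_div_iff₀ hdM, norm_sub_rev, mul_comm]
    refine hxy.trans ?_
    gcongr
  choose next hnext using hstep
  obtain ⟨x₀, hx₀, hx₀0, -⟩ := exists_root_near (w := 0) hr (hP 0) hM0 (by simpa using hr.le)
  let x : ∀ n, {x : K // ‖x‖ ≤ r ∧ (P n).eval x = 0} := fun n =>
    Nat.rec ⟨x₀, hx₀, hx₀0⟩ next n
  have hx : ∀ n, ‖(x (n + 1)).1 - (x n).1‖ ^ M ≤
      ‖d (n + M + 1)‖ * r ^ (n + M + 1) / ‖d M‖ := fun n => hnext n (x n)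
  have hcauchy : CauchySeq fun n => (x n).1 := by
    refine NonarchimedeanAddGroup.cauchySeq_of_tendsto_sub_nhds_zero ?_
    have h1 : Tendsto (fun n => ‖d (n + M + 1)‖ * r ^ (n + M + 1) / ‖d M‖) atTop (nhds 0) := by
      have := (hd.comp (tendsto_add_atTop_nat (M + 1))).div_const ‖d M‖
      simpa [Function.comp_def, add_assoc] using this
    have h2 := squeeze_zero (fun n => by positivity) hx h1
    rw [tendsto_zero_iff_norm_tendsto_zero, Metric.tendsto_atTop]
    intro ε hε
    obtain ⟨T, hT⟩ := eventually_atTop.1 (h2.eventually_lt_const (pow_pos hε M))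
    refine ⟨T, fun n hn => ?_⟩
    rw [Real.dist_0_eq_abs, abs_norm]
    exact lt_of_pow_lt_pow_left₀ M hε.le (hT n hn)
  obtain ⟨w, hw⟩ := cauchySeq_tendsto_of_complete hcauchy
  have hwr : ‖w‖ ≤ r := le_of_tendsto' hw.norm fun n => (x n).2.1
  refine ⟨w, hwr, hasSum_zero_of_tendsto_partial_sums hd hwr ?_⟩
  rw [← tendsto_add_atTop_iff_nat (M + 1)]
  have hdist : Tendsto (fun n => ‖d M‖ * r ^ M / r * ‖w - (x n).1‖) atTop (nhds 0) := by
    simpa using ((tendsto_const_nhds (x := w)).sub hw).norm.const_mul (‖d M‖ * r ^ M / r)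
  refine squeeze_zero_norm (fun n => ?_) hdist
  have hx0 := (x n).2.2
  rw [heval] at hx0
  have hsub : ∑ k ∈ Finset.range (n + M + 1), d k * w ^ k =
      ∑ k ∈ Finset.range (n + M + 1), (d k * w ^ k - d k * (x n).1 ^ k) := by
    rw [Finset.sum_sub_distrib, hx0, sub_zero]
  rw [← add_assoc, hsub]
  refine IsUltrametricDist.norm_sum_le_of_forall_le_of_nonneg (by positivity) fun k _ => ?_
  rw [← mul_sub, norm_mul, div_mul_eq_mul_div, le_div_iff₀ hr]
  calc ‖d k‖ * ‖w ^ k - (x n).1 ^ k‖ * r = ‖d k‖ * (‖w ^ k - (x n).1 ^ k‖ * r) := by ring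
    _ ≤ ‖d k‖ * (‖w - (x n).1‖ * r ^ k) := by
      exact mul_le_mul_of_nonneg_left (norm_pow_sub_pow_mul_le hwr (x n).2.1 k) (norm_nonneg _)
    _ = ‖d k‖ * r ^ k * ‖w - (x n).1‖ := by ring
    _ ≤ _ := by
      exact mul_le_mul_of_nonneg_right (hM.1 k) (norm_nonneg _)

theorem ne_zero_of_isLastMaxIndex_of_hasSum_zero {r : ℝ} {c : ℕ → K} {N : ℕ}
    (hN : IsLastMaxIndex (fun n => ‖c n‖ * r ^ n) N) {w : K} (hw : ‖w‖ ≤ r)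
    (hsum : HasSum (fun n => c n * w ^ n) 0) : N ≠ 0 := by
  rintro rfl
  have hr : 0 ≤ r := (norm_nonneg w).trans hw
  have hterm : ∀ n, ‖c (n + 1) * w ^ (n + 1)‖ < ‖c 0‖ := fun n => by
    rw [norm_mul, norm_pow]
    refine lt_of_le_of_lt ?_ (by simpa using hN.2 (n + 1) n.succ_pos)
    gcongr
  have hpartial : ∀ n, ‖∑ k ∈ Finset.range (n + 1), c k * w ^ k‖ = ‖c 0‖ := fun n => by
    induction n with
    | zero => simp
    | succ n ih =>
      rw [Finset.sum_range_succ, ← sub_neg_eq_add, norm_sub_eq_left_of_norm_lt, ih]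
      rw [norm_neg, ih]
      exact hterm n
  have hlim := ((tendsto_add_atTop_iff_nat 1).2 hsum.tendsto_sum_nat).norm
  simp only [hpartial, norm_zero] at hlim
  have h0 : ‖c 0‖ = 0 := tendsto_nhds_unique tendsto_const_nhds hlim
  exact absurd ((norm_nonneg _).trans_lt (hterm 0)) h0.not_gt

end Ultrametric

/-- Let `K` be an algebraically closed field, complete with respect to a nontrivial
non-Archimedean absolute value. Let `b ∈ K`, `r > 0`, and let
`f(z) = ∑ c_n (z - b)^n` be a nonzero power series with `‖c n‖ * r ^ n → 0` (so it
converges on the closed ball of radius `r` about `b`), having a zero in that ball.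
Here `N` is the largest index with `‖c n‖ * r ^ n` maximal (i.e. `N = K(f,r)`).
Then there is `ε > 0` such that every power series `g(z) = ∑ d_n (z - b)^n` with
`‖d n‖ * r ^ n → 0` and `‖c n - d n‖ < ε` for all `n ≤ N` has a zero in the ball. -/
theorem perturbed_series_has_zero
    {K : Type*} [NontriviallyNormedField K] [IsUltrametricDist K]
    [IsAlgClosed K] [CompleteSpace K]
    (b : K) (r : ℝ) (hr : 0 < r) (c : ℕ → K) (hc : c ≠ 0)
    (hc0 : Tendsto (fun n => ‖c n‖ * r ^ n) atTop (nhds 0))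
    (N : ℕ)
    (hNmax : ∀ m, ‖c m‖ * r ^ m ≤ ‖c N‖ * r ^ N)
    (hNlast : ∀ m, N < m → ‖c m‖ * r ^ m < ‖c N‖ * r ^ N)
    (hzero : ∃ z : K, ‖z - b‖ ≤ r ∧ HasSum (fun n => c n * (z - b) ^ n) 0) :
    ∃ ε > (0 : ℝ), ∀ d : ℕ → K,
      Tendsto (fun n => ‖d n‖ * r ^ n) atTop (nhds 0) →
      (∀ n ≤ N, ‖c n - d n‖ < ε) →
      ∃ z : K, ‖z - b‖ ≤ r ∧ HasSum (fun n => d n * (z - b) ^ n) 0 := by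
  obtain ⟨u, hu, husum⟩ := hzero
  have hN0 : N ≠ 0 := ne_zero_of_isLastMaxIndex_of_hasSum_zero ⟨hNmax, hNlast⟩ hu husum
  have hpos : 0 < ‖c N‖ * r ^ N :=
    lt_of_le_of_lt (by positivity) (hNlast (N + 1) (Nat.lt_succ_self N))
  have hcN : 0 < ‖c N‖ := pos_of_mul_pos_left hpos (by positivity)
  refine ⟨min ‖c N‖ (‖c N‖ * r ^ N), lt_min hcN hpos, fun d hd hcd => ?_⟩
  have hdN : ‖d N‖ = ‖c N‖ := by
    rw [← sub_sub_cancel (c N) (d N)]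
    exact norm_sub_eq_left_of_norm_lt ((hcd N le_rfl).trans_le (min_le_left _ _))
  have hd0 : ‖d 0‖ ≤ ‖d N‖ * r ^ N := by
    rw [hdN, ← sub_sub_cancel (c 0) (d 0)]
    refine (norm_sub_le_max_norm _ _).trans (max_le ?_ ?_)
    · simpa using hNmax 0
    · exact ((hcd 0 (Nat.zero_le N)).trans_le (min_le_right _ _)).le
  obtain ⟨M, hM⟩ := exists_isLastMaxIndex_of_tendsto_zero hd (N := N) (by rwa [hdN])
  have hM0 : M ≠ 0 := by
    rintro rfl
    have := hM.2 N (Nat.pos_of_ne_zero hN0)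
    simp only [pow_zero, mul_one] at this
    exact this.not_ge hd0
  obtain ⟨w, hw, hsum⟩ := exists_zero_of_isLastMaxIndex hr hd hM hM0
  exact ⟨w + b, by simpa using hw, by simpa using hsum⟩
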